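/- Let G be the line graph of a finite tree. Then mz(G) = mr^cr_ℤ(G), and this common value equals mr(G), mr_ℤ(G), γ(G) = γ_ℝ(G), and γ_ℤ(G). -/

import Mathlib

open scoped Classical

variable {V : Type*}

/-- The generalized Laplacian matrix `L(G, X_G)` of a simple graph `G`, with entries in the
polynomial ring `R[X_G]`: the `(u,v)` entry is the indeterminate `x_u` if `u = v`,
`-1` if `u` and `v` are adjacent, and `0` otherwise. -/
noncomputable def genLaplacian (R : Type*) [CommRing R] (G : SimpleGraph V) :
    Matrix V V (MvPolynomial V R) := fun u v =>
  if u = v then MvPolynomial.X u else if G.Adj u v then -1 else 0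

/-- The ideal generated by the determinants of all `i × i` submatrices of a square matrix. -/
noncomputable def minorsIdeal {S : Type*} [CommRing S] (M : Matrix V V S) (i : ℕ) : Ideal S :=
  Ideal.span { d : S | ∃ f g : Fin i → V, Function.Injective f ∧ Function.Injective g ∧
    d = (M.submatrix f g).det }

/-- The `i`-th critical ideal `I_i(G, X_G) ⊆ R[X_G]` of a simple graph `G`. -/
noncomputable def criticalIdeal (R : Type*) [CommRing R] (G : SimpleGraph V) (i : ℕ) :
    Ideal (MvPolynomial V R) :=
  minorsIdeal (genLaplacian R G) i

/-- The algebraic co-rank `γ_R(G)`: the largest `i` (with `0 ≤ i ≤ |V(G)|`) such that the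
`i`-th critical ideal of `G` over `R` is trivial (i.e. the whole ring). -/
noncomputable def algCoRank (R : Type*) [CommRing R] [Fintype V] (G : SimpleGraph V) : ℕ :=
  sSup {i | i ≤ Fintype.card V ∧ criticalIdeal R G i = ⊤}

/-- The rank of a square matrix over a commutative ring: the largest `k` such that some
`k × k` minor is nonzero and is not a zero divisor. -/
noncomputable def ringRank {R : Type*} [CommRing R] (M : Matrix V V R) : ℕ :=
  sSup {k | ∃ f g : Fin k → V, Function.Injective f ∧ Function.Injective g ∧
    (M.submatrix f g).det ≠ 0 ∧ (M.submatrix f g).det ∈ nonZeroDivisors R}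

/-- `A ∈ S_R(G)`: `A` is a symmetric matrix over `R`, indexed by the vertices of `G`, whose
off-diagonal `(u,v)` entry is nonzero iff `u` and `v` are adjacent (the diagonal is free). -/
def IsGraphMatrix {R : Type*} [CommRing R] (G : SimpleGraph V) (A : Matrix V V R) : Prop :=
  A.IsSymm ∧ ∀ u v : V, u ≠ v → (A u v ≠ 0 ↔ G.Adj u v)

/-- The minimum rank `mr_R(G)`: the smallest rank among matrices in `S_R(G)`. -/
noncomputable def minRank (R : Type*) [CommRing R] (G : SimpleGraph V) : ℕ :=
  sInf {k | ∃ A : Matrix V V R, IsGraphMatrix G A ∧ ringRank A = k}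

/-- The generalized Laplacian of `G` evaluated at a vector `d`: `L(G, d)` has `d u` on the
diagonal, `-1` at adjacent off-diagonal pairs and `0` elsewhere. -/
noncomputable def evalLaplacian {R : Type*} [CommRing R] (G : SimpleGraph V) (d : V → R) :
    Matrix V V R := fun u v =>
  if u = v then d u else if G.Adj u v then -1 else 0

/-- The critical minimum rank `mr^cr_R(G)`: the minimum of `rank (L(G,d))` over `d ∈ R^{V(G)}`. -/
noncomputable def crMinRank (R : Type*) [CommRing R] (G : SimpleGraph V) : ℕ :=
  sInf {k | ∃ d : V → R, ringRank (evalLaplacian G d) = k}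

/-- `a, b : Fin k → V` form a chronological list of forces for the zero forcing game on `G`
started with the vertices of `B` blue: at step `t` the force `a t → b t` is performed, which
requires that `a t` is blue, that `b t` is a white neighbor of `a t`, and that every white
neighbor of `a t` equals `b t`. -/
def IsChronList (G : SimpleGraph V) (B : Set V) {k : ℕ} (a b : Fin k → V) : Prop :=
  (∀ t, G.Adj (a t) (b t)) ∧
  (∀ t, a t ∈ B ∨ ∃ s, s < t ∧ b s = a t) ∧
  (∀ t, b t ∉ B ∧ ∀ s, s < t → b s ≠ b t) ∧
  (∀ t z, G.Adj (a t) z → z ∉ B → (∀ s, s < t → b s ≠ z) → z = b t)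

/-- `B` is a zero forcing set of `G`: starting with exactly `B` blue, there is a sequence of
forces turning every vertex of `G` blue. -/
def IsZeroForcingSet (G : SimpleGraph V) (B : Set V) : Prop :=
  ∃ (k : ℕ) (a b : Fin k → V), IsChronList G B a b ∧ ∀ v : V, v ∈ B ∨ ∃ t, b t = v

/-- The zero forcing number `Z(G)`: the minimum cardinality of a zero forcing set of `G`. -/
noncomputable def zeroForcingNumber [Fintype V] (G : SimpleGraph V) : ℕ :=
  sInf {m | ∃ B : Finset V, B.card = m ∧ IsZeroForcingSet G ↑B}

/-- `mz(G) = |V(G)| - Z(G)`. -/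
noncomputable def mz [Fintype V] (G : SimpleGraph V) : ℕ :=
  Fintype.card V - zeroForcingNumber G

theorem aux_ringRank_bdd {R : Type*} [CommRing R] [Fintype V] (M : Matrix V V R) :
    BddAbove {k | ∃ f g : Fin k → V, Function.Injective f ∧ Function.Injective g ∧
    (M.submatrix f g).det ≠ 0 ∧ (M.submatrix f g).det ∈ nonZeroDivisors R} := by
  refine ⟨Fintype.card V, ?_⟩
  rintro k ⟨f, g, hf, -⟩
  simpa using Fintype.card_le_of_injective f hf

/-- A nonsingular product through an index type of size `m` has size at most `m`. -/
theorem aux_det_mul_le {R : Type*} [CommRing R] [IsDomain R] {I : Type*} [Fintype I] {k : ℕ}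
    (P : Matrix (Fin k) I R) (Q : Matrix I (Fin k) R) (h : (P * Q).det ≠ 0) :
    k ≤ Fintype.card I := by
  let K := FractionRing R
  let φ : R →+* K := algebraMap R K
  have hdet : ((P.map φ) * (Q.map φ)).det ≠ 0 := by
    rw [← Matrix.map_mul, ← RingHom.mapMatrix_apply, ← RingHom.map_det]
    intro h0
    exact h ((map_eq_zero_iff φ (IsFractionRing.injective R K)).1 h0)
  have hu : IsUnit ((P.map φ) * (Q.map φ)) :=
    (Matrix.isUnit_iff_isUnit_det _).2 (isUnit_iff_ne_zero.2 hdet)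
  have h1 := Matrix.rank_of_isUnit _ hu
  have h2 := Matrix.rank_mul_le_left (P.map φ) (Q.map φ)
  have h3 := Matrix.rank_le_card_width (P.map φ)
  simp at h1
  omega

section Chron
variable {G : SimpleGraph V} {B : Set V} {k : ℕ} {a b : Fin k → V}

theorem IsChronList.inj_b (h : IsChronList G B a b) : Function.Injective b := by
  intro s t hst
  by_contra hne
  rcases lt_or_gt_of_ne hne with hlt | hlt
  · exact (h.2.2.1 t).2 s hlt hst
  · exact (h.2.2.1 s).2 t hlt hst.symm

theorem IsChronList.not_adj (h : IsChronList G B a b) {t s : Fin k} (hts : t < s) :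
    ¬ G.Adj (a t) (b s) := by
  intro hadj
  have := h.2.2.2 t (b s) hadj (h.2.2.1 s).1
    (fun r hr => (h.2.2.1 s).2 r (hr.trans hts))
  exact hts.ne' (h.inj_b this)

theorem IsChronList.ne (h : IsChronList G B a b) {t s : Fin k} (hts : t < s) :
    a t ≠ b s := by
  intro he
  rcases h.2.1 t with hB | ⟨r, hr, hb⟩
  · exact (h.2.2.1 s).1 (he ▸ hB)
  · exact (h.2.2.1 s).2 r (hr.trans hts) (hb.trans he)

theorem IsChronList.inj_a (h : IsChronList G B a b) : Function.Injective a := by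
  intro s t hst
  by_contra hne
  rcases lt_or_gt_of_ne hne with hlt | hlt
  · exact h.not_adj hlt (hst ▸ h.1 t)
  · exact h.not_adj hlt (hst ▸ h.1 s)

theorem IsChronList.det {S : Type*} [CommRing S] (h : IsChronList G B a b) (M : Matrix V V S)
    (hM : ∀ u v, u ≠ v → ¬ G.Adj u v → M u v = 0) :
    (M.submatrix a b).det = ∏ t, M (a t) (b t) := by
  rw [Matrix.det_of_lowerTriangular]
  · rfl
  · intro i j hij
    have hij' : i < j := hij
    exact hM _ _ (h.ne hij') (h.not_adj hij')

end Chron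

/-- `mz` is realized by a chronological list. -/
theorem aux_mz_chron [Fintype V] (G : SimpleGraph V) :
    ∃ (B : Set V) (a b : Fin (mz G) → V), IsChronList G B a b := by
  have hne : {m | ∃ B : Finset V, B.card = m ∧ IsZeroForcingSet G ↑B}.Nonempty := by
    refine ⟨_, Finset.univ, rfl, 0, Fin.elim0, Fin.elim0, ?_, by simp⟩
    refine ⟨fun t => t.elim0, fun t => t.elim0, fun t => t.elim0, fun t => t.elim0⟩
  obtain ⟨B, hB, k, a, b, h, hall⟩ := Nat.sInf_mem hne
  have hk : mz G = k := by
    have hc : Bᶜ = Finset.univ.image b := by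
      ext v
      simp only [Finset.mem_compl, Finset.mem_image, Finset.mem_univ, true_and]
      constructor
      · intro hv
        exact (hall v).resolve_left (by simpa using hv)
      · rintro ⟨t, rfl⟩
        simpa using (h.2.2.1 t).1
    have := congrArg Finset.card hc
    rw [Finset.card_compl, Finset.card_image_of_injective _ h.inj_b] at this
    simp at this
    rw [mz, zeroForcingNumber, ← hB, this]
  rw [hk]
  exact ⟨_, a, b, h⟩

theorem aux_le_mz [Fintype V] {G : SimpleGraph V} {k : ℕ} (a b : Fin k → V)
    (h : IsChronList G (Set.range b)ᶜ a b) : k ≤ mz G := by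
  have hmem : ((Finset.univ.image b)ᶜ : Finset V).card ∈
      {m | ∃ B : Finset V, B.card = m ∧ IsZeroForcingSet G ↑B} := by
    refine ⟨_, rfl, k, a, b, ?_, ?_⟩
    · simpa using h
    · intro v
      by_cases hv : ∃ t, b t = v
      · exact Or.inr hv
      · left; simpa using hv
  have hle := Nat.sInf_le hmem
  have hcard : (Finset.univ.image b).card ≤ Fintype.card V := Finset.card_le_univ _
  rw [Finset.card_compl] at hle
  rw [Finset.card_image_of_injective _ h.inj_b] at hle hcard
  simp at hle hcard
  unfold mz zeroForcingNumber
  omega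

theorem aux_le_ringRank {R : Type*} [CommRing R] [IsDomain R] [Fintype V] {G : SimpleGraph V}
    {A : Matrix V V R} (hA : IsGraphMatrix G A) : mz G ≤ ringRank A := by
  obtain ⟨B, a, b, h⟩ := aux_mz_chron G
  have hd : (A.submatrix a b).det ≠ 0 := by
    rw [h.det A]
    · exact Finset.prod_ne_zero_iff.2 fun t _ => (hA.2 _ _ (h.1 t).ne).2 (h.1 t)
    · intro u v huv hn
      by_contra h0
      exact hn ((hA.2 u v huv).1 h0)
  exact le_csSup (aux_ringRank_bdd A)
    ⟨a, b, h.inj_a, h.inj_b, hd, mem_nonZeroDivisors_of_ne_zero hd⟩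

theorem aux_isGraphMatrix {R : Type*} [CommRing R] [Nontrivial R] (G : SimpleGraph V) (d : V → R) :
    IsGraphMatrix G (evalLaplacian G d) := by
  constructor
  · ext u v
    simp only [Matrix.transpose_apply, evalLaplacian]
    by_cases h : u = v
    · subst h; rfl
    · simp [h, Ne.symm h, G.adj_comm]
  · intro u v huv
    by_cases h : G.Adj u v <;> simp [evalLaplacian, huv, h]

theorem aux_le_algCoRank (R : Type*) [CommRing R] [Fintype V] (G : SimpleGraph V) :
    mz G ≤ algCoRank R G := by
  obtain ⟨B, a, b, h⟩ := aux_mz_chron G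
  refine le_csSup ⟨Fintype.card V, fun i hi => hi.1⟩ ⟨Nat.sub_le _ _, ?_⟩
  refine Ideal.eq_top_of_isUnit_mem _ (Ideal.subset_span ⟨a, b, h.inj_a, h.inj_b, rfl⟩) ?_
  rw [h.det]
  · have : ∀ t, genLaplacian R G (a t) (b t) = -1 := by
      intro t
      simp [genLaplacian, (h.1 t).ne, h.1 t]
    simp only [this]
    rw [Finset.prod_const]
    exact (isUnit_one.neg).pow _
  · intro u v huv hn
    simp [genLaplacian, huv, hn]

/-- If all nonzero minors of `L(G,d)` have size at most `m`, everything is at most `m`. -/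
theorem aux_ringRank_le {R : Type*} [CommRing R] (M : Matrix V V R) (m : ℕ)
    (hm : ∀ k (f g : Fin k → V), (M.submatrix f g).det ≠ 0 → k ≤ m) : ringRank M ≤ m := by
  unfold ringRank
  by_cases hne : {k | ∃ f g : Fin k → V, Function.Injective f ∧ Function.Injective g ∧
    (M.submatrix f g).det ≠ 0 ∧ (M.submatrix f g).det ∈ nonZeroDivisors R}.Nonempty
  · refine csSup_le hne ?_
    rintro k ⟨f, g, -, -, h, -⟩
    exact hm k f g h
  · rw [Set.not_nonempty_iff_eq_empty.1 hne]; simp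

theorem aux_algCoRank_le {R : Type*} [CommRing R] [Nontrivial R] [Fintype V] (G : SimpleGraph V)
    (d : V → R) (m : ℕ)
    (hm : ∀ k (f g : Fin k → V), ((evalLaplacian G d).submatrix f g).det ≠ 0 → k ≤ m) :
    algCoRank R G ≤ m := by
  refine csSup_le' ?_
  rintro i ⟨-, hi⟩
  by_contra hlt
  have hle : criticalIdeal R G i ≤ RingHom.ker (MvPolynomial.eval d) := by
    refine Ideal.span_le.2 ?_
    rintro _ ⟨f, g, -, -, rfl⟩
    rw [SetLike.mem_coe, RingHom.mem_ker, RingHom.map_det]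
    by_contra h0
    apply hlt
    apply hm i f g
    convert h0 using 2
    ext x y
    simp only [Matrix.submatrix_apply, RingHom.mapMatrix_apply, Matrix.map_apply, genLaplacian,
      evalLaplacian]
    split_ifs <;> simp
  rw [hi, top_le_iff] at hle
  exact RingHom.ker_ne_top _ hle

/-- Reduction to a combinatorial and a factorization statement. -/
theorem aux_main [Fintype V] (G : SimpleGraph V) (m : ℕ) (hmz : m ≤ mz G)
    (hfac : ∀ (R : Type) [CommRing R] [IsDomain R], ∃ d : V → R,
      ∀ k (f g : Fin k → V), ((evalLaplacian G d).submatrix f g).det ≠ 0 → k ≤ m) :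
    mz G = crMinRank ℤ G ∧ mz G = minRank ℝ G ∧ mz G = minRank ℤ G ∧
    mz G = algCoRank ℝ G ∧ mz G = algCoRank ℤ G := by
  have hmr : ∀ (R : Type) [CommRing R] [IsDomain R], mz G = minRank R G := by
    intro R _ _
    obtain ⟨d, hd⟩ := hfac R
    refine le_antisymm ?_ ?_
    · refine le_csInf ⟨_, _, aux_isGraphMatrix G d, rfl⟩ ?_
      rintro _ ⟨A, hA, rfl⟩
      exact aux_le_ringRank hA
    · have h1 : minRank R G ≤ ringRank (evalLaplacian G d) :=
        Nat.sInf_le ⟨_, aux_isGraphMatrix G d, rfl⟩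
      exact h1.trans ((aux_ringRank_le _ m hd).trans hmz)
  have hg : ∀ (R : Type) [CommRing R] [IsDomain R], mz G = algCoRank R G := by
    intro R _ _
    obtain ⟨d, hd⟩ := hfac R
    exact le_antisymm (aux_le_algCoRank R G) ((aux_algCoRank_le G d m hd).trans hmz)
  refine ⟨?_, hmr ℝ, hmr ℤ, hg ℝ, hg ℤ⟩
  obtain ⟨d, hd⟩ := hfac ℤ
  refine le_antisymm ?_ ?_
  · refine le_csInf ⟨_, d, rfl⟩ ?_
    rintro _ ⟨d', rfl⟩
    exact aux_le_ringRank (aux_isGraphMatrix G d')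
  · have h1 : crMinRank ℤ G ≤ ringRank (evalLaplacian G d) := Nat.sInf_le ⟨d, rfl⟩
    exact h1.trans ((aux_ringRank_le _ m hd).trans hmz)

section Tree
variable {W : Type*} {T : SimpleGraph W}

/-- Vertices with at least two neighbours. -/
def InternalVert (T : SimpleGraph W) (v : W) : Prop :=
  ∃ x y, x ≠ y ∧ T.Adj v x ∧ T.Adj v y

theorem aux_common_unique {e f : T.edgeSet} (hef : e ≠ f) {v w : W}
    (hv : v ∈ e.1) (hv' : v ∈ f.1) (hw : w ∈ e.1) (hw' : w ∈ f.1) : v = w := by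
  by_contra hne
  apply hef
  apply Subtype.ext
  rw [(Sym2.mem_and_mem_iff hne).1 ⟨hv, hw⟩, (Sym2.mem_and_mem_iff hne).1 ⟨hv', hw'⟩]

theorem aux_lineGraph_adj {e f : T.edgeSet} :
    T.lineGraph.Adj e f ↔ e ≠ f ∧ ∃ v, v ∈ e.1 ∧ v ∈ f.1 := by
  rw [SimpleGraph.lineGraph_adj_iff_exists]

theorem aux_internal_of_common {e f : T.edgeSet} (hef : e ≠ f) {v : W}
    (hv : v ∈ e.1) (hv' : v ∈ f.1) : InternalVert T v := by
  obtain ⟨e, he⟩ := e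
  obtain ⟨f, hf⟩ := f
  obtain ⟨x, rfl⟩ := Sym2.mem_iff_exists.1 hv
  obtain ⟨y, rfl⟩ := Sym2.mem_iff_exists.1 hv'
  refine ⟨x, y, ?_, he, hf⟩
  rintro rfl
  exact hef rfl

theorem aux_factor [Fintype W] (R : Type*) [CommRing R] [IsDomain R] :
    ∃ d : T.edgeSet → R, ∀ k (f g : Fin k → T.edgeSet),
      ((evalLaplacian T.lineGraph d).submatrix f g).det ≠ 0 →
      k ≤ Fintype.card {v // InternalVert T v} := by
  let N : Matrix T.edgeSet {v // InternalVert T v} R := fun e v => if v.1 ∈ e.1 then 1 else 0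
  let N' : Matrix {v // InternalVert T v} T.edgeSet R := fun v e => if v.1 ∈ e.1 then -1 else 0
  refine ⟨fun e => (N * N') e e, ?_⟩
  have hL : evalLaplacian T.lineGraph (fun e => (N * N') e e) = N * N' := by
    ext e f
    unfold evalLaplacian
    split_ifs with h1 h2
    · rw [h1]
    · rw [aux_lineGraph_adj] at h2
      obtain ⟨hne, v, hv, hv'⟩ := h2
      have hi := aux_internal_of_common hne hv hv'
      rw [Matrix.mul_apply, Finset.sum_eq_single ⟨v, hi⟩]
      · simp [N, N', hv, hv']
      · intro w _ hw
        by_cases h3 : w.1 ∈ e.1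
        · by_cases h4 : w.1 ∈ f.1
          · exact absurd (Subtype.ext (aux_common_unique hne h3 h4 hv hv')) hw
          · simp [N', h4]
        · simp [N, h3]
      · simp
    · rw [Matrix.mul_apply, Finset.sum_eq_zero]
      intro w _
      by_cases h3 : w.1 ∈ e.1
      · by_cases h4 : w.1 ∈ f.1
        · exact absurd (aux_lineGraph_adj.2 ⟨h1, w.1, h3, h4⟩) h2
        · simp [N', h4]
      · simp [N, h3]
  intro k f g h
  rw [hL] at h
  exact aux_det_mul_le (N.submatrix f id) (N'.submatrix id g) h

theorem aux_unique_closer (hT : T.IsTree) (r : W) {v x y : W} (hx : T.Adj v x) (hy : T.Adj v y)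
    (hdx : T.dist r x < T.dist r v) (hdy : T.dist r y < T.dist r v) : x = y := by
  obtain ⟨q, hq, hql⟩ := hT.connected.exists_path_of_dist r v
  have key : ∀ u, T.Adj v u → T.dist r u < T.dist r v → u = q.penultimate := by
    intro u hu hdu
    obtain ⟨p, hp, hpl⟩ := hT.connected.exists_path_of_dist r u
    refine hT.isAcyclic.eq_penultimate_of_adj_end hq hu ?_
    by_contra hnot
    have hv : v ∈ p.support :=
      hT.isAcyclic.mem_support_of_ne_mem_support_of_adj_of_isPath hp hq hu.symm hnot
    have := congrArg SimpleGraph.Walk.length (hT.isAcyclic.path_concat hq hp hu hv)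
    rw [SimpleGraph.Walk.length_concat] at this
    omega
  rw [key x hx hdx, key y hy hdy]

theorem aux_exists_closer (hT : T.IsTree) {r v : W} (hne : v ≠ r) :
    ∃ u, T.Adj v u ∧ T.dist r v = T.dist r u + 1 := by
  obtain ⟨p, hp⟩ := hT.connected.exists_walk_length_eq_dist v r
  cases p with
  | nil => exact absurd rfl hne
  | @cons _ u _ h w =>
    refine ⟨u, h, ?_⟩
    have h1 := SimpleGraph.dist_le w
    rw [SimpleGraph.Walk.length_cons] at hp
    rw [SimpleGraph.dist_comm (u := r), SimpleGraph.dist_comm (u := r)]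
    rcases hT.dist_eq_dist_add_one_of_adj r h with h2 | h2 <;>
      rw [SimpleGraph.dist_comm (u := r), SimpleGraph.dist_comm (u := r)] at h2 <;> omega

theorem aux_root [Fintype W] (hT : T.IsTree) : ∃ r, ¬ InternalVert T r := by
  have := hT.connected.nonempty
  rcases subsingleton_or_nontrivial W with hs | hn
  · refine ⟨Classical.arbitrary W, ?_⟩
    rintro ⟨x, y, hxy, -⟩
    exact hxy (Subsingleton.elim _ _)
  · obtain ⟨r, hr⟩ := hT.exists_vert_degree_one_of_nontrivial
    refine ⟨r, ?_⟩
    rintro ⟨x, y, hxy, hx, hy⟩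
    exact hxy ((SimpleGraph.degree_eq_one_iff_existsUnique_adj.1 hr).unique hx hy)

theorem aux_tree_le_mz [Fintype W] (hT : T.IsTree) :
    Fintype.card {v // InternalVert T v} ≤ mz T.lineGraph := by
  obtain ⟨r, hr⟩ := aux_root hT
  have hex : ∀ v : {v // InternalVert T v}, ∃ p c, T.Adj v.1 p ∧ T.Adj v.1 c ∧
      T.dist r v.1 = T.dist r p + 1 ∧ T.dist r c = T.dist r v.1 + 1 := by
    rintro ⟨v, hv⟩
    have hne : v ≠ r := by rintro rfl; exact hr hv
    obtain ⟨p, hp, hpd⟩ := aux_exists_closer hT hne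
    obtain ⟨x, y, hxy, hx, hy⟩ := hv
    rcases hT.dist_eq_dist_add_one_of_adj r hx with h1 | h1
    · rcases hT.dist_eq_dist_add_one_of_adj r hy with h2 | h2
      · exact absurd (aux_unique_closer hT r hx hy (by omega) (by omega)) hxy
      · exact ⟨p, y, hp, hy, hpd, h2⟩
    · exact ⟨p, x, hp, hx, hpd, h1⟩
  choose p c hp hc hpd hcd using hex
  let ι := {v // InternalVert T v}
  let e₀ : Fin (Fintype.card ι) ≃ ι := (Fintype.equivFin ι).symm
  let F : Fin (Fintype.card ι) → ℤ := fun t => - (T.dist r (e₀ t).1 : ℤ)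
  let e : Fin (Fintype.card ι) ≃ ι := (Tuple.sort F).trans e₀
  have hmono : ∀ s t, s ≤ t → T.dist r (e t).1 ≤ T.dist r (e s).1 := by
    intro s t hst
    have := Tuple.monotone_sort F hst
    change -(T.dist r (e₀ (Tuple.sort F s)).1 : ℤ) ≤ -(T.dist r (e₀ (Tuple.sort F t)).1 : ℤ) at this
    change T.dist r (e₀ (Tuple.sort F t)).1 ≤ T.dist r (e₀ (Tuple.sort F s)).1
    omega
  have hlt : ∀ s t, T.dist r (e t).1 < T.dist r (e s).1 → s < t := by
    intro s t h
    by_contra hn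
    have := hmono t s (not_lt.1 hn)
    omega
  let bb : ι → T.edgeSet := fun v => ⟨s(v.1, p v), hp v⟩
  let aa : ι → T.edgeSet := fun v => ⟨s(v.1, c v), hc v⟩
  -- a vertex `w` is determined by its parent edge
  have hbinj : Function.Injective bb := by
    intro v w h
    have h' : s(v.1, p v) = s(w.1, p w) := congrArg Subtype.val h
    rcases Sym2.eq_iff.1 h' with ⟨h1, -⟩ | ⟨h1, h2⟩
    · exact Subtype.ext h1
    · have := hpd v; have := hpd w
      rw [h2, h1] at *
      omega
  refine aux_le_mz (aa ∘ e) (bb ∘ e) ⟨?_, ?_, ?_, ?_⟩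
  · intro t
    refine aux_lineGraph_adj.2 ⟨?_, (e t).1, by simp [aa], by simp [bb]⟩
    intro h
    have h' : s((e t).1, c (e t)) = s((e t).1, p (e t)) := congrArg Subtype.val h
    have h2 := Sym2.congr_right.1 h'
    have h3 := hpd (e t); have h4 := hcd (e t)
    rw [h2] at h4
    omega
  · intro t
    by_cases hm : aa (e t) ∈ Set.range (bb ∘ e)
    · right
      obtain ⟨s, hs⟩ := hm
      refine ⟨s, ?_, hs⟩
      have h' : s((e s).1, p (e s)) = s((e t).1, c (e t)) := congrArg Subtype.val hs
      have h3 := hpd (e s); have h4 := hcd (e t)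
      apply hlt
      rcases Sym2.eq_iff.1 h' with ⟨h1, h2⟩ | ⟨h1, h2⟩
      · rw [h1, h2] at h3
        omega
      · rw [h1]
        omega
    · exact Or.inl hm
  · intro t
    refine ⟨fun h => h ⟨t, rfl⟩, fun s hs h => ?_⟩
    exact hs.ne (e.injective (hbinj h))
  · intro t z hadj hz hnot
    have hz' : z ∈ Set.range (bb ∘ e) := by simpa using hz
    obtain ⟨s, rfl⟩ := hz'
    have hts : ¬ s < t := fun h => hnot s h rfl
    have hd : ¬ T.dist r (e t).1 < T.dist r (e s).1 := fun h => hts (hlt _ _ h)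
    obtain ⟨-, v, hv1, hv2⟩ := aux_lineGraph_adj.1 hadj
    have hv1' : v = (e t).1 ∨ v = c (e t) := by simpa [aa] using hv1
    have hv2' : v = (e s).1 ∨ v = p (e s) := by simpa [bb] using hv2
    have h3 := hpd (e s); have h4 := hcd (e t)
    rcases hv1' with h1 | h1 <;> rcases hv2' with h2 | h2
    · have : e s = e t := Subtype.ext (h2.symm.trans h1)
      simp [this]
    · rw [← h2, h1] at h3; omega
    · rw [← h1, h2] at h4; omega
    · rw [← h2, h1] at h3; omega

end Tree

/-- Let `G` be the line graph of a finite tree `T`.  Then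
`mz(G) = mr^cr_ℤ(G)`, and this common value equals `mr(G) = mr_ℝ(G)`, `mr_ℤ(G)`,
`γ(G) = γ_ℝ(G)`, and `γ_ℤ(G)`. -/
theorem lineGraph_of_tree_mz_eq_crMinRank {W : Type*} [Fintype W] (T : SimpleGraph W)
    (hconn : T.Connected) (hacyc : T.IsAcyclic) :
    mz T.lineGraph = crMinRank ℤ T.lineGraph ∧
    mz T.lineGraph = minRank ℝ T.lineGraph ∧
    mz T.lineGraph = minRank ℤ T.lineGraph ∧
    mz T.lineGraph = algCoRank ℝ T.lineGraph ∧
    mz T.lineGraph = algCoRank ℤ T.lineGraph :=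
  aux_main _ _ (aux_tree_le_mz ⟨hconn, hacyc⟩) (fun R _ _ => aux_factor R)
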